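/- Let N ≥ 3 and k ≥ 3 be integers and let p be a prime with p ∤ N. (a) Define F₀ := Σ_{1 ≤ m ≤ N, gcd(m,N)=1} E_k(·, (0,m), N). Then for every τ in the upper half-plane, p^{k−1}·F₀(pτ) + (1/p)·Σ_{j=0}^{p−1} F₀((τ+j)/p) = (p^{k−1}+1)·F₀(τ); i.e. F₀ is an eigenfunction of the Hecke operator T_p with eigenvalue p^{k−1}+1. (b) Let δ ∣ N with 1 ≤ δ < N/2 and λ₀ ∈ ℤ with gcd(λ₀, gcd(δ, N/δ)) = 1, and define E^{(0)}_k((δ,λ₀), N) := Σ_{(a,λ₂) ∈ I(λ₀)} E_k^{(1)}((aδ, λ₂), N), where I(λ₀) := {(a,λ₂) ∈ ℤ² : 0 ≤ a ≤ N/δ−1, gcd(a, N/δ)=1, 0 ≤ λ₂ ≤ δ−1, gcd(λ₂, δ)=1, a·λ₂ ≡ λ₀ (mod gcd(δ, N/δ))}. Then for every τ: p^{k−1}·E^{(0)}_k((δ,λ₀), N)(pτ) + (1/p)·Σ_{j=0}^{p−1} E^{(0)}_k((δ,λ₀), N)((τ+j)/p) = p^{k−1}·E^{(0)}_k((δ,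 pλ₀), N)(τ) + E^{(0)}_k((δ, p'λ₀), N)(τ), where p' ∈ ℤ satisfies p·p' ≡ 1 (mod N). -/

import Mathlib

open Complex UpperHalfPlane

noncomputable section

def epsN (N : ℕ) : ℂ := if 3 ≤ N then 1 else 1/2

/-- normalized Eisenstein series of weight `k` on `Γ(N)` -/
def Ek (k N : ℕ) (lam : ZMod N × ZMod N) : ℍ → ℂ :=
  fun τ => epsN N * ∑' cd : ℤ × ℤ,
    if Int.gcd cd.1 cd.2 = 1 ∧ (cd.1 : ZMod N) = lam.1 ∧ (cd.2 : ZMod N) = lam.2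
    then ((cd.1 : ℂ) * (τ : ℂ) + (cd.2 : ℂ)) ^ (-(k : ℤ)) else 0

/-- the orbital sum `E_k^{(1)}(λ, N)` for `Γ₁(N)`. -/
def Ek1 (k N : ℕ) (lam : ℤ × ℤ) : ℍ → ℂ :=
  fun τ => ∑ n ∈ Finset.range (N / Int.gcd lam.1 (N : ℤ)),
    Ek k N ((lam.1 : ZMod N),
      ((lam.2 + (Int.gcd lam.1 (N : ℤ) : ℤ) * (n : ℤ) : ℤ) : ZMod N)) τ

/-- the `Γ₀(N)` orbital sum `F₀ = E_k^{(0)}((0,1), N)`. -/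
def F0 (k N : ℕ) : ℍ → ℂ :=
  fun τ => ∑ m ∈ Finset.Icc 1 N,
    if Nat.gcd m N = 1 then Ek k N ((0 : ZMod N), (m : ZMod N)) τ else 0

/-- the `Γ₀(N)` orbital sum `E_k^{(0)}((δ,λ₀), N)`. -/
def E0 (k N δ : ℕ) (l₀ : ℤ) : ℍ → ℂ :=
  fun τ => ∑ a ∈ Finset.range (N / δ), ∑ l ∈ Finset.range δ,
    if Nat.gcd a (N / δ) = 1 ∧ Nat.gcd l δ = 1 ∧
        (((a * l : ℕ) : ZMod (Nat.gcd δ (N / δ))) = ((l₀ : ℤ) : ZMod (Nat.gcd δ (N / δ))))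
    then Ek1 k N (((a : ℤ) * (δ : ℤ)), (l : ℤ)) τ
    else 0

/-- the point `p·τ` of `ℍ`, for a positive natural `p`. -/
def scaleH (p : ℕ) (hp : 0 < p) (τ : ℍ) : ℍ :=
  ⟨(p : ℂ) * (τ : ℂ), by
    have h : ((p : ℂ) * (τ : ℂ)).im = (p : ℝ) * (τ : ℂ).im := by
      simp [Complex.mul_im]
    rw [h]
    exact mul_pos (by exact_mod_cast hp) τ.2⟩

/-- the point `(τ+j)/p` of `ℍ`, for a positive natural `p` and `j : ℕ`. -/
def shiftH (j p : ℕ) (hp : 0 < p) (τ : ℍ) : ℍ :=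
  ⟨((τ : ℂ) + (j : ℂ)) / (p : ℂ), by
    have h : (((τ : ℂ) + (j : ℂ)) / (p : ℂ)).im = (τ : ℂ).im / (p : ℝ) := by
      rw [show ((p : ℂ)) = ((p : ℝ) : ℂ) by push_cast; ring, Complex.div_ofReal_im]
      simp
    rw [h]
    exact div_pos τ.2 (by exact_mod_cast hp)⟩

/-- The summand `(cτ+d)^{-k}` of the lattice sums defining Eisenstein series. -/
def latticeTerm (k : ℕ) (τ : ℍ) (v : ℤ × ℤ) : ℂ :=
  ((v.1 : ℂ) * (τ : ℂ) + (v.2 : ℂ)) ^ (-(k : ℤ))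

/-- The sum of `u` over the lattice vectors belonging to `A`. -/
def latticeSum (u : ℤ × ℤ → ℂ) (A : Set (ℤ × ℤ)) : ℂ := ∑' v, A.indicator u v

lemma summable_latticeTerm {k : ℕ} (hk : 3 ≤ k) (τ : ℍ) : Summable (latticeTerm k τ) :=
  (summable_prod_eisSummand hk τ).congr fun v ↦ by
    simp [EisensteinSeries.eisSummand, latticeTerm]

lemma latticeSum_split {u : ℤ × ℤ → ℂ} (hu : Summable u) (A B : Set (ℤ × ℤ)) :
    latticeSum u A = latticeSum u (A ∩ B) + latticeSum u (A ∩ Bᶜ) := by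
  rw [latticeSum, latticeSum, latticeSum,
    ← (hu.indicator (A ∩ B)).tsum_add (hu.indicator (A ∩ Bᶜ))]
  refine tsum_congr fun v ↦ ?_
  by_cases hA : v ∈ A <;> by_cases hB : v ∈ B <;> simp [hA, hB]

lemma latticeSum_comp {u w : ℤ × ℤ → ℂ} {A B : Set (ℤ × ℤ)} {φ : ℤ × ℤ → ℤ × ℤ} {c : ℂ}
    (hφ : Function.Injective φ) (hA : A ⊆ Set.range φ) (hAB : ∀ v, φ v ∈ A ↔ v ∈ B)
    (huw : ∀ v, u (φ v) = c * w v) : latticeSum u A = c * latticeSum w B := by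
  rw [latticeSum, latticeSum, ← tsum_mul_left,
    ← hφ.tsum_eq (Set.support_indicator_subset.trans hA)]
  refine tsum_congr fun v ↦ ?_
  by_cases hv : v ∈ B
  · simp [hv, (hAB v).2 hv, huw]
  · simp [hv, mt (hAB v).1 hv]

lemma sum_latticeSum_of_existsUnique {ι : Type*} {u : ℤ × ℤ → ℂ} (hu : Summable u)
    (s : Finset ι) (A : ι → Set (ℤ × ℤ)) (B : Set (ℤ × ℤ)) (hAB : ∀ i ∈ s, A i ⊆ B)
    (hB : ∀ v ∈ B, ∃! i, i ∈ s ∧ v ∈ A i) :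
    ∑ i ∈ s, latticeSum u (A i) = latticeSum u B := by
  unfold latticeSum
  rw [← Summable.tsum_finsetSum fun i _ ↦ hu.indicator (A i)]
  refine tsum_congr fun v ↦ ?_
  by_cases hv : v ∈ B
  · obtain ⟨i, ⟨hi, hvi⟩, huniq⟩ := hB v hv
    rw [Finset.sum_eq_single_of_mem i hi fun j hj hji ↦
      Set.indicator_of_notMem (fun hvj ↦ hji (huniq j ⟨hj, hvj⟩)) u]
    simp [hv, hvi]
  · rw [Set.indicator_of_notMem hv]
    exact Finset.sum_eq_zero fun i hi ↦ Set.indicator_of_notMem (fun h ↦ hv (hAB i hi h)) u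

lemma existsUnique_residue {m : ℕ} (hm : 0 < m) (x : ℤ) :
    ∃! j : ℕ, j ∈ Finset.range m ∧ (m : ℤ) ∣ x - j := by
  have hm' : (0 : ℤ) < m := by exact_mod_cast hm
  have h0 := Int.emod_nonneg x hm'.ne'
  have h1 := Int.emod_lt_of_pos x hm'
  have h2 : ((x % m).toNat : ℤ) = x % m := Int.toNat_of_nonneg h0
  refine ⟨(x % m).toNat, ⟨Finset.mem_range.2 (by omega), ?_⟩, ?_⟩
  · rw [h2]
    exact Int.dvd_self_sub_emod
  · rintro j ⟨hj, hd⟩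
    rw [Finset.mem_range] at hj
    have h3 : x % m = (j : ℤ) % m :=
      Int.emod_eq_emod_iff_emod_sub_eq_zero.2 (Int.emod_eq_zero_of_dvd hd)
    rw [Int.emod_eq_of_lt (a := (j : ℤ)) (by omega) (by exact_mod_cast hj)] at h3
    omega

lemma existsUnique_dvd_sub_mul {p : ℕ} (hp : p.Prime) {c : ℤ} (hc : ¬ (p : ℤ) ∣ c) (d : ℤ) :
    ∃! j : ℕ, j ∈ Finset.range p ∧ (p : ℤ) ∣ d - c * j := by
  have hcop : IsCoprime (p : ℤ) c :=
    (Prime.coprime_iff_not_dvd (Nat.prime_iff_prime_int.1 hp)).2 hc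
  obtain ⟨a, b, hab⟩ := hcop
  have key (j : ℕ) : (p : ℤ) ∣ d - c * j ↔ (p : ℤ) ∣ b * d - j := by
    refine ⟨fun h ↦ ?_, fun h ↦ ?_⟩
    · have : b * d - j = b * (d - c * j) - p * (a * j) := by linear_combination (j : ℤ) * hab
      rw [this]
      exact (h.mul_left b).sub (dvd_mul_right _ _)
    · have : d - c * j = c * (b * d - j) + p * (a * d) := by linear_combination (-d) * hab
      rw [this]
      exact (h.mul_left c).add (dvd_mul_right _ _)
  simpa only [key] using existsUnique_residue hp.pos (b * d)

/-- Primitive lattice vectors satisfying `Q`. -/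
def primitiveSet (Q : ℤ → ℤ → Prop) : Set (ℤ × ℤ) := {v | IsCoprime v.1 v.2 ∧ Q v.1 v.2}

lemma latticeTerm_smul (k : ℕ) (τ : ℍ) (p : ℕ) (c d : ℤ) :
    latticeTerm k τ ((p : ℤ) * c, (p : ℤ) * d) = ((p : ℂ) ^ k)⁻¹ * latticeTerm k τ (c, d) := by
  simp only [latticeTerm, zpow_neg, zpow_natCast, ← mul_inv, ← mul_pow]
  push_cast
  ring_nf

lemma latticeTerm_scaleH (k : ℕ) (τ : ℍ) {p : ℕ} (hp : 0 < p) (c d : ℤ) :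
    latticeTerm k (scaleH p hp τ) (c, d) = latticeTerm k τ ((p : ℤ) * c, d) := by
  simp only [latticeTerm, scaleH, UpperHalfPlane.coe_mk]
  push_cast
  ring_nf

lemma latticeTerm_shiftH (k : ℕ) (τ : ℍ) {p : ℕ} (hp : 0 < p) (j : ℕ) (c d : ℤ) :
    latticeTerm k (shiftH j p hp τ) (c, d) =
      (p : ℂ) ^ k * latticeTerm k τ (c, c * j + (p : ℤ) * d) := by
  have hp' : (p : ℂ) ≠ 0 := by exact_mod_cast hp.ne'
  simp only [latticeTerm, shiftH, UpperHalfPlane.coe_mk, zpow_neg, zpow_natCast]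
  push_cast
  rw [show (c : ℂ) * ((τ + j) / p) + d = (c * τ + (c * j + p * d)) / p by field_simp; ring,
    div_pow, inv_div, div_eq_mul_inv]

section Hecke

variable {k p : ℕ} {Q Q₁ Q₂ : ℤ → ℤ → Prop}

lemma isCoprime_mul_left_prime_iff (hp : p.Prime) {c d : ℤ} :
    IsCoprime ((p : ℤ) * c) d ↔ IsCoprime c d ∧ ¬ (p : ℤ) ∣ d := by
  rw [IsCoprime.mul_left_iff, Prime.coprime_iff_not_dvd (Nat.prime_iff_prime_int.1 hp), and_comm]

lemma isCoprime_mul_right_prime_iff (hp : p.Prime) {c d : ℤ} :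
    IsCoprime c ((p : ℤ) * d) ↔ IsCoprime c d ∧ ¬ (p : ℤ) ∣ c := by
  rw [isCoprime_comm, isCoprime_mul_left_prime_iff hp, isCoprime_comm]

lemma latticeSum_scaleH (hk : 3 ≤ k) (hp : p.Prime) (τ : ℍ)
    (h₁ : ∀ c d, Q₁ (p * c) d ↔ Q c d) (h₂ : ∀ c d, Q c (p * d) ↔ Q₂ c d) :
    latticeSum (latticeTerm k (scaleH p hp.pos τ)) (primitiveSet Q) =
      latticeSum (latticeTerm k τ) (primitiveSet Q₁ ∩ {v | (p : ℤ) ∣ v.1}) +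
        ((p : ℂ) ^ k)⁻¹ *
          latticeSum (latticeTerm k τ) (primitiveSet Q₂ ∩ {v | (p : ℤ) ∣ v.1}ᶜ) := by
  have hp0 : (p : ℤ) ≠ 0 := by exact_mod_cast hp.ne_zero
  rw [latticeSum_split (summable_latticeTerm hk _) _ {v | (p : ℤ) ∣ v.2}, add_comm]
  congr 1
  · symm
    rw [← one_mul (latticeSum _ (_ ∩ _ᶜ))]
    refine latticeSum_comp (φ := fun v ↦ ((p : ℤ) * v.1, v.2)) ?_ ?_ ?_ ?_
    · rintro ⟨a, b⟩ ⟨c, d⟩ h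
      simpa [hp.ne_zero] using h
    · rintro ⟨_, d⟩ ⟨-, c, rfl⟩
      exact ⟨(c, d), rfl⟩
    · rintro ⟨c, d⟩
      simp only [primitiveSet, Set.mem_inter_iff, Set.mem_ofPred_eq, Set.mem_compl_iff, h₁,
        isCoprime_mul_left_prime_iff hp, dvd_mul_right]
      tauto
    · rintro ⟨c, d⟩
      rw [latticeTerm_scaleH, one_mul]
  · refine latticeSum_comp (φ := fun v ↦ (v.1, (p : ℤ) * v.2)) ?_ ?_ ?_ ?_
    · rintro ⟨a, b⟩ ⟨c, d⟩ h
      simpa [hp.ne_zero] using h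
    · rintro ⟨c, _⟩ ⟨-, d, rfl⟩
      exact ⟨(c, d), rfl⟩
    · rintro ⟨c, d⟩
      simp only [primitiveSet, Set.mem_inter_iff, Set.mem_ofPred_eq, Set.mem_compl_iff, h₂,
        isCoprime_mul_right_prime_iff hp, dvd_mul_right]
      tauto
    · rintro ⟨c, d⟩
      rw [latticeTerm_scaleH, latticeTerm_smul]

lemma latticeSum_shiftH (hk : 3 ≤ k) (hp : p.Prime) (τ : ℍ) (j : ℕ)
    (h₁ : ∀ c d, Q₁ c (p * d) ↔ Q c d) (h₁' : ∀ c d, Q₁ c (c * j + d) ↔ Q₁ c d)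
    (h₂ : ∀ c d, Q (p * c) d ↔ Q₂ c d) (h₂' : ∀ c d, Q₂ c (c * j + d) ↔ Q₂ c d) :
    latticeSum (latticeTerm k (shiftH j p hp.pos τ)) (primitiveSet Q) =
      (p : ℂ) ^ k * latticeSum (latticeTerm k τ)
          (primitiveSet Q₁ ∩ {v | (p : ℤ) ∣ v.1}ᶜ ∩ {v | (p : ℤ) ∣ v.2 - v.1 * j}) +
        latticeSum (latticeTerm k τ) (primitiveSet Q₂ ∩ {v | (p : ℤ) ∣ v.2 - v.1 * j}ᶜ) := by
  have hp0 : (p : ℤ) ≠ 0 := by exact_mod_cast hp.ne_zero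
  have hpk : (p : ℂ) ^ k ≠ 0 := pow_ne_zero _ (by exact_mod_cast hp.ne_zero)
  rw [latticeSum_split (summable_latticeTerm hk _) _ {v | (p : ℤ) ∣ v.1}, add_comm]
  congr 1
  · rw [← inv_mul_eq_iff_eq_mul₀ hpk]
    symm
    refine latticeSum_comp (φ := fun v ↦ (v.1, v.1 * j + (p : ℤ) * v.2)) ?_ ?_ ?_ ?_
    · rintro ⟨a, b⟩ ⟨c, d⟩ h
      simp only [Prod.mk.injEq] at h ⊢
      obtain ⟨rfl, h⟩ := h
      simpa [hp.ne_zero] using h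
    · rintro ⟨c, d⟩ ⟨-, e, he⟩
      refine ⟨(c, e), ?_⟩
      simp only [Prod.mk.injEq, true_and]
      simp only at he
      linarith
    · rintro ⟨c, d⟩
      simp only [primitiveSet, Set.mem_inter_iff, Set.mem_ofPred_eq, Set.mem_compl_iff, h₁', h₁,
        add_sub_cancel_left, dvd_mul_right, IsCoprime.mul_add_left_right_iff,
        isCoprime_mul_right_prime_iff hp]
      tauto
    · rintro ⟨c, d⟩
      rw [latticeTerm_shiftH, inv_mul_cancel_left₀ hpk]
  · rw [← one_mul (latticeSum (latticeTerm k τ) _)]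
    refine latticeSum_comp (φ := fun v ↦ ((p : ℤ) * v.1, v.2 - v.1 * j)) ?_ ?_ ?_ ?_
    · rintro ⟨a, b⟩ ⟨c, d⟩ h
      simp only [Prod.mk.injEq, mul_eq_mul_left_iff, hp0, or_false] at h ⊢
      obtain ⟨rfl, h⟩ := h
      simpa using h
    · rintro ⟨_, d⟩ ⟨-, c, rfl⟩
      exact ⟨(c, d + c * j), by simp⟩
    · rintro ⟨c, d⟩
      have h3 := h₂' c (d - c * j)
      have h4 : IsCoprime c (c * j + (d - c * j)) ↔ IsCoprime c (d - c * j) :=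
        IsCoprime.mul_add_left_right_iff
      rw [add_sub_cancel] at h3 h4
      simp only [primitiveSet, Set.mem_inter_iff, Set.mem_ofPred_eq, Set.mem_compl_iff, h₂,
        isCoprime_mul_left_prime_iff hp, dvd_mul_right, ← h3, ← h4]
      tauto
    · rintro ⟨c, d⟩
      rw [latticeTerm_shiftH,
        show (p : ℤ) * c * j + p * (d - c * j) = p * d by ring, latticeTerm_smul,
        mul_inv_cancel_left₀ hpk, one_mul]

lemma hecke_latticeSum (hk : 3 ≤ k) (hp : p.Prime) (τ : ℍ)
    (h₁l : ∀ c d, Q₁ (p * c) d ↔ Q c d) (h₁r : ∀ c d, Q₁ c (p * d) ↔ Q c d)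
    (h₁ : ∀ c d (j : ℕ), Q₁ c (c * j + d) ↔ Q₁ c d)
    (h₂l : ∀ c d, Q (p * c) d ↔ Q₂ c d) (h₂r : ∀ c d, Q c (p * d) ↔ Q₂ c d)
    (h₂ : ∀ c d (j : ℕ), Q₂ c (c * j + d) ↔ Q₂ c d) :
    (p : ℂ) ^ (k - 1) * latticeSum (latticeTerm k (scaleH p hp.pos τ)) (primitiveSet Q) +
        (1 / (p : ℂ)) * ∑ j ∈ Finset.range p,
          latticeSum (latticeTerm k (shiftH j p hp.pos τ)) (primitiveSet Q) =
      (p : ℂ) ^ (k - 1) * latticeSum (latticeTerm k τ) (primitiveSet Q₁) +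
        latticeSum (latticeTerm k τ) (primitiveSet Q₂) := by
  have hsum := summable_latticeTerm hk τ
  have hp0 : (p : ℂ) ≠ 0 := by exact_mod_cast hp.ne_zero
  have hndvd (c d : ℤ) (j : ℕ) (hcd : IsCoprime c d) (hd : (p : ℤ) ∣ d - c * j) :
      ¬ (p : ℤ) ∣ c := fun hc ↦
    (Nat.prime_iff_prime_int.1 hp).not_isUnit
      (hcd.isUnit_of_dvd' hc ((dvd_sub_left (hc.mul_right _)).1 hd))
  have e₁ : ∑ j ∈ Finset.range p, latticeSum (latticeTerm k τ)
      (primitiveSet Q₁ ∩ {v | (p : ℤ) ∣ v.1}ᶜ ∩ {v | (p : ℤ) ∣ v.2 - v.1 * j}) =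
      latticeSum (latticeTerm k τ) (primitiveSet Q₁ ∩ {v | (p : ℤ) ∣ v.1}ᶜ) := by
    refine sum_latticeSum_of_existsUnique hsum _ _ _ (fun _ _ ↦ Set.inter_subset_left) ?_
    rintro ⟨c, d⟩ ⟨hv, hc⟩
    simpa [hv, hc] using existsUnique_dvd_sub_mul hp hc d
  have e₂ : ∑ j ∈ Finset.range p, latticeSum (latticeTerm k τ)
      (primitiveSet Q₂ ∩ {v | (p : ℤ) ∣ v.2 - v.1 * j}) =
      latticeSum (latticeTerm k τ) (primitiveSet Q₂ ∩ {v | (p : ℤ) ∣ v.1}ᶜ) := by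
    refine sum_latticeSum_of_existsUnique hsum _ _ _ ?_ ?_
    · rintro j - ⟨c, d⟩ ⟨hv, hd⟩
      exact ⟨hv, hndvd c d j hv.1 hd⟩
    · rintro ⟨c, d⟩ ⟨hv, hc⟩
      simpa [hv] using existsUnique_dvd_sub_mul hp hc d
  have e₃ : ∑ j ∈ Finset.range p, latticeSum (latticeTerm k τ)
      (primitiveSet Q₂ ∩ {v | (p : ℤ) ∣ v.2 - v.1 * j}ᶜ) =
      p * latticeSum (latticeTerm k τ) (primitiveSet Q₂) -
        latticeSum (latticeTerm k τ) (primitiveSet Q₂ ∩ {v | (p : ℤ) ∣ v.1}ᶜ) := by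
    rw [← e₂, eq_sub_iff_add_eq, ← Finset.sum_add_distrib]
    simp [add_comm (latticeSum _ (_ ∩ _ᶜ)), ← latticeSum_split hsum]
  rw [latticeSum_scaleH hk hp τ h₁l h₂r, Finset.sum_congr rfl fun j _ ↦
    latticeSum_shiftH hk hp τ j h₁r (h₁ · · j) h₂l (h₂ · · j), Finset.sum_add_distrib,
    ← Finset.mul_sum, e₁, e₃, latticeSum_split hsum (primitiveSet Q₁) {v | (p : ℤ) ∣ v.1}]
  obtain ⟨k, rfl⟩ : ∃ m, k = m + 1 := ⟨k - 1, by omega⟩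
  rw [Nat.add_sub_cancel, pow_succ]
  field_simp
  ring

end Hecke

/-- The condition cutting out the `Γ₀(δM)`-orbit attached to the pair `(δ, l)`. -/
def OrbitCondition (δ M : ℕ) (l c d : ℤ) : Prop :=
  ∃ c₁ : ℤ, c = δ * c₁ ∧ IsCoprime c₁ M ∧ (Nat.gcd δ M : ℤ) ∣ c₁ * d - l

lemma orbitCondition_mul_add (δ M : ℕ) (l c d : ℤ) (j : ℕ) :
    OrbitCondition δ M l c (c * j + d) ↔ OrbitCondition δ M l c d := by
  have hg : (Nat.gcd δ M : ℤ) ∣ δ := by exact_mod_cast Nat.gcd_dvd_left δ M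
  refine exists_congr fun c₁ ↦ and_congr_right fun hc ↦ and_congr_right fun _ ↦ ?_
  rw [show c₁ * (c * j + d) - l = δ * (c₁ * c₁ * j) + (c₁ * d - l) by rw [hc]; ring]
  exact dvd_add_right (hg.mul_right _)

section OrbitCondition

variable {δ M p : ℕ} {l l' : ℤ}

lemma orbitCondition_mul_right
    (hg : ∀ x, (Nat.gcd δ M : ℤ) ∣ p * x - l ↔ (Nat.gcd δ M : ℤ) ∣ x - l')
    (c d : ℤ) : OrbitCondition δ M l c (p * d) ↔ OrbitCondition δ M l' c d := by
  refine exists_congr fun c₁ ↦ and_congr_right fun _ ↦ and_congr_right fun _ ↦ ?_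
  rw [mul_left_comm, hg]

lemma orbitCondition_mul_left (hp : p ≠ 0) (hpδ : IsCoprime (p : ℤ) δ) (hpM : IsCoprime (p : ℤ) M)
    (hg : ∀ x, (Nat.gcd δ M : ℤ) ∣ p * x - l ↔ (Nat.gcd δ M : ℤ) ∣ x - l')
    (c d : ℤ) : OrbitCondition δ M l (p * c) d ↔ OrbitCondition δ M l' c d := by
  have hp' : (p : ℤ) ≠ 0 := by exact_mod_cast hp
  constructor
  · rintro ⟨c₁, hc, hcop, hd⟩
    obtain ⟨c₂, rfl⟩ : (p : ℤ) ∣ c₁ := hpδ.dvd_of_dvd_mul_left (hc ▸ dvd_mul_right _ _)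
    refine ⟨c₂, ?_, hcop.of_mul_left_right, ?_⟩
    · rw [mul_left_comm] at hc
      exact mul_left_cancel₀ hp' hc
    · rwa [← hg, ← mul_assoc]
  · rintro ⟨c₁, rfl, hcop, hd⟩
    exact ⟨p * c₁, by ring, hpM.mul_left hcop, by rwa [mul_assoc, hg]⟩

end OrbitCondition

lemma hecke_orbitSum {k p δ M : ℕ} (hk : 3 ≤ k) (hp : p.Prime) (hpδM : ¬ p ∣ δ * M) {l p' : ℤ}
    (hp' : (Nat.gcd δ M : ℤ) ∣ p * p' - 1) (τ : ℍ) :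
    (p : ℂ) ^ (k - 1) *
          latticeSum (latticeTerm k (scaleH p hp.pos τ)) (primitiveSet (OrbitCondition δ M l)) +
        (1 / (p : ℂ)) * ∑ j ∈ Finset.range p,
          latticeSum (latticeTerm k (shiftH j p hp.pos τ)) (primitiveSet (OrbitCondition δ M l)) =
      (p : ℂ) ^ (k - 1) *
          latticeSum (latticeTerm k τ) (primitiveSet (OrbitCondition δ M (p * l))) +
        latticeSum (latticeTerm k τ) (primitiveSet (OrbitCondition δ M (p' * l))) := by
  have hcop : IsCoprime (p : ℤ) ((δ * M : ℕ) : ℤ) :=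
    Nat.isCoprime_iff_coprime.2 ((Nat.Prime.coprime_iff_not_dvd hp).2 hpδM)
  rw [Nat.cast_mul] at hcop
  have hpδ := hcop.of_mul_right_left
  have hpM := hcop.of_mul_right_right
  have hpg : IsCoprime (Nat.gcd δ M : ℤ) p :=
    (hpδ.of_isCoprime_of_dvd_right (by exact_mod_cast Nat.gcd_dvd_left δ M)).symm
  have h₁ (x : ℤ) : (Nat.gcd δ M : ℤ) ∣ p * x - p * l ↔ (Nat.gcd δ M : ℤ) ∣ x - l := by
    rw [← mul_sub]
    exact ⟨hpg.dvd_of_dvd_mul_left, fun h ↦ h.mul_left _⟩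
  have h₂ (x : ℤ) : (Nat.gcd δ M : ℤ) ∣ p * x - l ↔ (Nat.gcd δ M : ℤ) ∣ x - p' * l := by
    rw [show (p : ℤ) * x - l = p * (x - p' * l) + (p * p' - 1) * l by ring,
      dvd_add_left (hp'.mul_right l)]
    exact ⟨hpg.dvd_of_dvd_mul_left, fun h ↦ h.mul_left _⟩
  exact hecke_latticeSum hk hp τ (orbitCondition_mul_left hp.ne_zero hpδ hpM h₁)
    (orbitCondition_mul_right h₁) (orbitCondition_mul_add δ M _)
    (orbitCondition_mul_left hp.ne_zero hpδ hpM h₂) (orbitCondition_mul_right h₂)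
    (orbitCondition_mul_add δ M _)

lemma Ek_eq_latticeSum {k N : ℕ} (hN : 3 ≤ N) (c₀ d₀ : ℤ) (τ : ℍ) :
    Ek k N ((c₀ : ZMod N), (d₀ : ZMod N)) τ =
      latticeSum (latticeTerm k τ)
        (primitiveSet fun c d ↦ (N : ℤ) ∣ c - c₀ ∧ (N : ℤ) ∣ d - d₀) := by
  classical
  rw [Ek, epsN, if_pos hN, one_mul, latticeSum]
  refine tsum_congr fun v ↦ ?_
  rw [Set.indicator_apply]
  refine if_congr ?_ rfl rfl
  simp only [primitiveSet, Set.mem_ofPred_eq, Int.isCoprime_iff_gcd_eq_one,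
    eq_comm (a := (v.1 : ZMod N)), eq_comm (a := (v.2 : ZMod N)),
    ZMod.intCast_eq_intCast_iff_dvd_sub]

lemma F0_eq_latticeSum {k N : ℕ} (hk : 3 ≤ k) (hN : 3 ≤ N) (l : ℤ) (τ : ℍ) :
    F0 k N τ = latticeSum (latticeTerm k τ) (primitiveSet (OrbitCondition N 1 l)) := by
  have hE (m : ℕ) := Ek_eq_latticeSum (k := k) hN 0 m τ
  simp only [Int.cast_zero, Int.cast_natCast, sub_zero] at hE
  simp only [F0, hE]
  rw [← Finset.sum_filter]
  refine sum_latticeSum_of_existsUnique (summable_latticeTerm hk τ) _ _ _ ?_ ?_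
  · rintro m - ⟨c, d⟩ ⟨hcd, ⟨c₁, hc⟩, -⟩
    exact ⟨hcd, c₁, hc, by simpa using isCoprime_one_right, by simp⟩
  · rintro ⟨c, d⟩ ⟨hcd, c₁, hc, -⟩
    dsimp only at hcd hc
    subst hc
    obtain ⟨m, ⟨hm, hdm⟩, huniq⟩ := existsUnique_residue (show 0 < N by omega) d
    have hcop : Nat.gcd m N = 1 := by
      obtain ⟨e, he⟩ := hdm
      have h := hcd.of_mul_left_left
      rw [show d = (m : ℤ) + N * e by linarith, IsCoprime.add_mul_left_right_iff] at h
      exact Nat.isCoprime_iff_coprime.1 h.symm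
    have hm0 : m ≠ 0 := by
      rintro rfl
      rw [Nat.gcd_zero_left] at hcop
      omega
    rw [Finset.mem_range] at hm
    refine ⟨m, ⟨?_, hcd, dvd_mul_right _ _, hdm⟩, ?_⟩
    · rw [Finset.mem_filter, Finset.mem_Icc]
      exact ⟨⟨by omega, hm.le⟩, hcop⟩
    · rintro n ⟨hn, -, -, hdn⟩
      rw [Finset.mem_filter, Finset.mem_Icc] at hn
      have hnN : n ≠ N := by
        rintro rfl
        have := hn.2
        rw [Nat.gcd_self] at this
        omega
      exact huniq n ⟨Finset.mem_range.2 (by omega), hdn⟩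

lemma E0_eq_latticeSum {k δ M : ℕ} (hk : 3 ≤ k) (hN : 3 ≤ δ * M) (l₀ : ℤ) (τ : ℍ) :
    E0 k (δ * M) δ l₀ τ =
      latticeSum (latticeTerm k τ) (primitiveSet (OrbitCondition δ M l₀)) := by
  have hδ : 0 < δ := Nat.pos_of_ne_zero (by rintro rfl; omega)
  have hM : 0 < M := Nat.pos_of_ne_zero (by rintro rfl; omega)
  have hδ' : (δ : ℤ) ≠ 0 := by exact_mod_cast hδ.ne'
  have hE (a l : ℕ) (ha : Nat.gcd a M = 1) : Ek1 k (δ * M) ((a : ℤ) * (δ : ℤ), (l : ℤ)) τ =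
      ∑ n ∈ Finset.range M, latticeSum (latticeTerm k τ) (primitiveSet fun c d ↦
        ((δ * M : ℕ) : ℤ) ∣ c - a * δ ∧ ((δ * M : ℕ) : ℤ) ∣ d - (l + δ * n)) := by
    have hgcd : Int.gcd ((a : ℤ) * δ) ((δ * M : ℕ) : ℤ) = δ := by
      rw [← Nat.cast_mul, Int.gcd_natCast_natCast, mul_comm a, Nat.gcd_mul_left, ha, mul_one]
    simp only [Ek1, hgcd, Nat.mul_div_cancel_left M hδ, Ek_eq_latticeSum hN]
  set C : ℕ × ℕ → Prop := fun x ↦ Nat.gcd x.1 M = 1 ∧ Nat.gcd x.2 δ = 1 ∧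
    (((x.1 * x.2 : ℕ) : ZMod (Nat.gcd δ M)) = (l₀ : ZMod (Nat.gcd δ M))) with hC
  have hCdvd (a l : ℕ) : ((a * l : ℕ) : ZMod (Nat.gcd δ M)) = (l₀ : ZMod (Nat.gcd δ M)) ↔
      (Nat.gcd δ M : ℤ) ∣ a * l - l₀ := by
    rw [← Int.cast_natCast, eq_comm, ZMod.intCast_eq_intCast_iff_dvd_sub, Nat.cast_mul]
  have hgδ : (Nat.gcd δ M : ℤ) ∣ δ := by exact_mod_cast Nat.gcd_dvd_left δ M
  have hgM : (Nat.gcd δ M : ℤ) ∣ M := by exact_mod_cast Nat.gcd_dvd_right δ M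
  have hsum : E0 k (δ * M) δ l₀ τ =
      ∑ i ∈ ((Finset.range M ×ˢ Finset.range δ).filter C) ×ˢ Finset.range M,
        latticeSum (latticeTerm k τ) (primitiveSet fun c d ↦
          ((δ * M : ℕ) : ℤ) ∣ c - i.1.1 * δ ∧ ((δ * M : ℕ) : ℤ) ∣ d - (i.1.2 + δ * i.2)) := by
    rw [Finset.sum_product, Finset.sum_filter, Finset.sum_product, E0,
      Nat.mul_div_cancel_left M hδ]
    refine Finset.sum_congr rfl fun a _ ↦ Finset.sum_congr rfl fun l _ ↦ ?_
    by_cases h : C (a, l)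
    · rw [if_pos h, if_pos h, hE a l h.1]
    · rw [if_neg h, if_neg h]
  rw [hsum]
  refine sum_latticeSum_of_existsUnique (summable_latticeTerm hk τ) _ _ _ ?_ ?_
  · rintro ⟨⟨a, l⟩, n⟩ hi ⟨c, d⟩ ⟨hcd, ⟨t, ht⟩, ⟨s, hs⟩⟩
    simp only [Finset.mem_product, Finset.mem_filter, hC, hCdvd] at hi
    obtain ⟨⟨-, ha, -, hal⟩, -⟩ := hi
    push_cast at ht hs
    refine ⟨hcd, a + M * t, by linear_combination ht, ?_, ?_⟩
    · rw [IsCoprime.add_mul_left_left_iff]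
      exact Nat.isCoprime_iff_coprime.2 ha
    · dsimp only
      rw [show ((a : ℤ) + M * t) * d - l₀ =
        (a * l - l₀) + (M * (t * d) + δ * (a * (n + M * s))) by linear_combination (a : ℤ) * hs]
      exact hal.add ((hgM.mul_right _).add (hgδ.mul_right _))
  · rintro ⟨c, d⟩ ⟨hcd, c₁, hc, hcop, hd⟩
    dsimp only at hcd hc hd
    subst hc
    obtain ⟨a, ⟨ha, t, hat⟩, ha'⟩ := existsUnique_residue hM c₁
    obtain ⟨l, ⟨hl, e, hle⟩, hl'⟩ := existsUnique_residue hδ d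
    obtain ⟨n, ⟨hn, s, hns⟩, hn'⟩ := existsUnique_residue hM e
    refine ⟨((a, l), n), ⟨?_, hcd, ⟨t, ?_⟩, ⟨s, ?_⟩⟩, ?_⟩
    · simp only [Finset.mem_product, Finset.mem_filter, hC, hCdvd]
      refine ⟨⟨⟨ha, hl⟩, ?_, ?_, ?_⟩, hn⟩
      · rw [show c₁ = a + M * t by linarith, IsCoprime.add_mul_left_left_iff] at hcop
        exact Nat.isCoprime_iff_coprime.1 hcop
      · have h := hcd.of_mul_left_left
        rw [show d = l + δ * e by linarith, IsCoprime.add_mul_left_right_iff] at h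
        exact Nat.isCoprime_iff_coprime.1 h.symm
      · rw [show (a : ℤ) * l - l₀ = (c₁ * d - l₀) - (M * (t * d) + δ * (a * e)) by
          linear_combination (-d) * hat - (a : ℤ) * hle]
        exact hd.sub ((hgM.mul_right _).add (hgδ.mul_right _))
    · push_cast
      linear_combination (δ : ℤ) * hat
    · push_cast
      linear_combination hle + (δ : ℤ) * hns
    · rintro ⟨⟨b, m⟩, q⟩ ⟨hi, -, ⟨t', ht'⟩, ⟨s', hs'⟩⟩
      simp only [Finset.mem_product, Finset.mem_filter] at hi
      push_cast at ht' hs'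
      obtain rfl : b = a := ha' b ⟨hi.1.1.1, t', mul_left_cancel₀ hδ' (by linear_combination ht')⟩
      obtain rfl : m = l := hl' m ⟨hi.1.1.2, q + M * s', by linear_combination hs'⟩
      obtain rfl : q = n :=
        hn' q ⟨hi.2, s', mul_left_cancel₀ hδ' (by linear_combination hs' - hle)⟩
      rfl

/-- Hecke action on the `Γ₀(N)` spectral Eisenstein series: (a) `F₀`
is a `T_p`-eigenfunction with eigenvalue `p^{k−1}+1`; (b) `T_p E^{(0)}_k((δ,λ₀)) =
p^{k−1}·E^{(0)}_k((δ,pλ₀)) + E^{(0)}_k((δ,p'λ₀))` where `p·p' ≡ 1 (mod N)`. -/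
theorem heckeTp_Gamma0_eisenstein (N k : ℕ) (hN : 3 ≤ N) (hk : 3 ≤ k)
    (p : ℕ) (hp : p.Prime) (hpN : ¬ (p ∣ N)) :
    (∀ τ : ℍ,
      (p : ℂ) ^ (k - 1) * F0 k N (scaleH p hp.pos τ) +
        (1 / (p : ℂ)) * ∑ j ∈ Finset.range p, F0 k N (shiftH j p hp.pos τ) =
      ((p : ℂ) ^ (k - 1) + 1) * F0 k N τ) ∧
    (∀ (δ : ℕ), δ ∣ N → 1 ≤ δ → 2 * δ < N →
      ∀ (l₀ : ℤ), Int.gcd l₀ ((Nat.gcd δ (N / δ) : ℤ)) = 1 →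
      ∀ (p' : ℤ), (((p : ℤ) * p' : ℤ) : ZMod N) = 1 →
      ∀ τ : ℍ,
        (p : ℂ) ^ (k - 1) * E0 k N δ l₀ (scaleH p hp.pos τ) +
          (1 / (p : ℂ)) * ∑ j ∈ Finset.range p, E0 k N δ l₀ (shiftH j p hp.pos τ) =
        (p : ℂ) ^ (k - 1) * E0 k N δ ((p : ℤ) * l₀) τ + E0 k N δ (p' * l₀) τ) := by
  refine ⟨fun τ ↦ ?_, ?_⟩
  · have h := hecke_orbitSum (δ := N) (M := 1) (l := 0) (p' := 0) hk hp (by rwa [mul_one])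
      (by simp) τ
    simp only [← F0_eq_latticeSum hk hN] at h
    rw [h, add_mul, one_mul]
  · rintro δ ⟨M, rfl⟩ hδ - l₀ - p' hp' τ
    have hpg : (Nat.gcd δ M : ℤ) ∣ p * p' - 1 := by
      rw [← Int.cast_one, eq_comm, ZMod.intCast_eq_intCast_iff_dvd_sub] at hp'
      refine dvd_trans ?_ hp'
      exact_mod_cast (Nat.gcd_dvd_left δ M).mul_right M
    simpa only [← E0_eq_latticeSum hk hN] using hecke_orbitSum hk hp hpN (l := l₀) hpg τ
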